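/- Let y ∈ T' and let A be a gauge field on T satisfying (τA)(y,x) = 0 for all x ∈ B(y). Then Σ_{b ⊂ B(y)} A(b)² ≤ 3L³ · Σ_{p ⊂ B(y)} dA(p)², where the sums run over the unordered bonds and the plaquettes all of whose vertices lie in B(y). -/

import Mathlib

open Finset

noncomputable section

/-- Points of the discrete torus `(ℤ/Nℤ)³`. -/
abbrev TPt (N : ℕ) : Type := Fin 3 → ZMod N

/-- The standard unit vector `e_μ` in the torus. -/
def unitVec (N : ℕ) (μ : Fin 3) : TPt N := fun i => if i = μ then 1 else 0

/-- The representative of `a ∈ ℤ/Nℤ` in the symmetric range `{-(N-1)/2, …, (N-1)/2}`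
(for odd `N`). -/
def symRep (N : ℕ) (a : ZMod N) : ℤ :=
  if 2 * (a.val : ℤ) + 1 ≤ (N : ℤ) then (a.val : ℤ) else (a.val : ℤ) - (N : ℤ)

/-- Shift a torus point by `k` steps in direction `μ`. -/
def shiftT {N : ℕ} (z : TPt N) (μ : Fin 3) (k : ℤ) : TPt N :=
  fun i => if i = μ then z i + (k : ZMod N) else z i

/-- The sum of the gauge field `A` along the straight lattice path from `z` to `z + t·e_μ`. -/
def segT {N : ℕ} (A : TPt N → TPt N → ℝ) (z : TPt N) (μ : Fin 3) (t : ℤ) : ℝ :=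
  if 0 ≤ t then ∑ j ∈ Finset.range t.toNat, A (shiftT z μ (j : ℤ)) (shiftT z μ ((j : ℤ) + 1))
  else ∑ j ∈ Finset.range (-t).toNat, A (shiftT z μ (-(j : ℤ))) (shiftT z μ (-(j : ℤ) - 1))

/-- The field strength `dA` on the plaquette based at `x` spanned by `e_μ, e_ν`. -/
def plaqT {N : ℕ} (A : TPt N → TPt N → ℝ) (x : TPt N) (μ ν : Fin 3) : ℝ :=
  A x (x + unitVec N μ) + A (x + unitVec N μ) (x + unitVec N μ + unitVec N ν)
    + A (x + unitVec N μ + unitVec N ν) (x + unitVec N ν) + A (x + unitVec N ν) x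

/-- The corner of the rectilinear path `Γ^π_{yx}` reached after the first `m` coordinate
moves. -/
def interPtT {N : ℕ} (y x : TPt N) (π : Equiv.Perm (Fin 3)) (m : ℕ) : TPt N :=
  fun i => if ((π.symm i : Fin 3) : ℕ) < m then x i else y i

/-- `A(Γ^π_{yx})`: the sum of `A` along the rectilinear path (not wrapping around the
torus) from `y` to `x`, moving the coordinates to their final values in the order
`π 0, π 1, π 2`; the coordinate increments are the symmetric representatives of `x - y`. -/
def gammaSumT {N : ℕ} (A : TPt N → TPt N → ℝ) (π : Equiv.Perm (Fin 3)) (y x : TPt N) : ℝ :=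
  ∑ m : Fin 3, segT A (interPtT y x π (m : ℕ)) (π m) (symRep N (x (π m) - y (π m)))

/-- `(τA)(y,x) = (1/6) Σ_π A(Γ^π_{yx})`, averaged over the `3! = 6` permutations. -/
def tauBlk {N : ℕ} (A : TPt N → TPt N → ℝ) (y x : TPt N) : ℝ :=
  (1 / 6) * ∑ π : Equiv.Perm (Fin 3), gammaSumT A π y x

/-- The block of radius `R` centered at `y`: all `x` whose coordinates relative to `y`
have symmetric representative of absolute value at most `R`. -/
def blockF (N : ℕ) [NeZero N] (R : ℤ) (y : TPt N) : Finset (TPt N) :=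
  Finset.univ.filter fun x => ∀ i, |symRep N (x i - y i)| ≤ R

/-- Membership in the coarse lattice `(Lℤ/Nℤ)³ ⊆ (ℤ/Nℤ)³`. -/
def isCoarse (L N : ℕ) (y : TPt N) : Prop :=
  ∀ i, ∃ c : ZMod N, y i = (L : ZMod N) * c

/-- The coarse unit vector `L·e_μ`. -/
def cUnitVec (L N : ℕ) (μ : Fin 3) : TPt N := fun i => if i = μ then (L : ZMod N) else 0

/-- The block-averaged field on coarse bonds:
`(QA)(y, y+Le_μ) = L⁻⁴ Σ_{x ∈ B(y)} A(Γ_{x,x+Le_μ})`. -/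
def Qc (L : ℕ) {N : ℕ} [NeZero N] (A : TPt N → TPt N → ℝ) (y : TPt N) (μ : Fin 3) : ℝ :=
  ((L : ℝ) ^ 4)⁻¹ * ∑ x ∈ blockF N (((L : ℤ) - 1) / 2) y, segT A x μ (L : ℤ)

/-- Signed sum of `f` from `0` to `t`. -/
def SS (f : ℤ → ℝ) (t : ℤ) : ℝ :=
  if 0 ≤ t then ∑ j ∈ Finset.range t.toNat, f (j : ℤ)
  else -∑ j ∈ Finset.range (-t).toNat, f (-(j : ℤ) - 1)

lemma SS_tele (g : ℤ → ℝ) (t : ℤ) : SS (fun j => g (j + 1) - g j) t = g t - g 0 := by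
  unfold SS
  split_ifs with h
  · obtain ⟨n, rfl⟩ := Int.eq_ofNat_of_zero_le h
    have := Finset.sum_range_sub (fun j : ℕ => g (j : ℤ)) n
    simpa using this
  · obtain ⟨n, hn⟩ := Int.eq_ofNat_of_zero_le (show 0 ≤ -t by omega)
    obtain rfl : t = -(n : ℤ) := by omega
    have := Finset.sum_range_sub' (fun j : ℕ => g (-(j : ℤ))) n
    simp only [neg_neg, Int.toNat_natCast]
    simp only [Nat.cast_zero, neg_zero] at this
    have e : ∀ j ∈ Finset.range n, g (-(j : ℤ) - 1 + 1) - g (-(j : ℤ) - 1)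
        = g (-(j : ℤ)) - g (-((j + 1 : ℕ) : ℤ)) := by
      intro j _
      congr 2 <;> push_cast <;> ring
    rw [Finset.sum_congr rfl e, this]
    ring

lemma SS_sub (f g : ℤ → ℝ) (t : ℤ) : SS (fun j => f j - g j) t = SS f t - SS g t := by
  unfold SS
  split_ifs
  · rw [Finset.sum_sub_distrib]
  · rw [Finset.sum_sub_distrib]; ring

lemma SS_add (f g : ℤ → ℝ) (t : ℤ) : SS (fun j => f j + g j) t = SS f t + SS g t := by
  unfold SS
  split_ifs
  · rw [Finset.sum_add_distrib]
  · rw [Finset.sum_add_distrib]; ring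

lemma SS_succ (f : ℤ → ℝ) (t : ℤ) : SS f (t + 1) = SS f t + f t := by
  unfold SS
  by_cases h : 0 ≤ t
  · obtain ⟨n, rfl⟩ := Int.eq_ofNat_of_zero_le h
    rw [if_pos h, if_pos (by omega)]
    rw [show ((n : ℤ) + 1).toNat = n + 1 by omega, Finset.sum_range_succ]
    simp
  · obtain ⟨n, hn⟩ := Int.eq_ofNat_of_zero_le (show 0 ≤ -t - 1 by omega)
    obtain rfl : t = -(n : ℤ) - 1 := by omega
    rw [if_neg h, show (-(-(n : ℤ) - 1)).toNat = n + 1 by omega, Finset.sum_range_succ]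
    rcases Nat.eq_zero_or_pos n with rfl | hpos
    · simp
    · rw [if_neg (by omega), show (-(-(n : ℤ) - 1 + 1)).toNat = n by omega]
      ring

lemma SS_sq (f : ℤ → ℝ) (R t : ℤ) (h1 : -R ≤ t) (h2 : t ≤ R) :
    SS f t ^ 2 ≤ R * ∑ j ∈ Finset.Icc (-R) (R - 1), f j ^ 2 := by
  have key : ∀ (n : ℕ) (c : ℕ → ℤ), (n : ℤ) ≤ R → Function.Injective c →
      (∀ j < n, c j ∈ Finset.Icc (-R) (R - 1)) →
      (∑ j ∈ Finset.range n, f (c j)) ^ 2 ≤ R * ∑ j ∈ Finset.Icc (-R) (R - 1), f j ^ 2 := by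
    intro n c hn hc hm
    have a := sq_sum_le_card_mul_sum_sq (s := Finset.range n) (f := fun j => f (c j))
    rw [Finset.card_range] at a
    refine a.trans ?_
    have hn' : (n : ℝ) ≤ (R : ℝ) := by exact_mod_cast hn
    have b : ∑ j ∈ Finset.range n, f (c j) ^ 2 ≤ ∑ j ∈ Finset.Icc (-R) (R - 1), f j ^ 2 := by
      rw [← Finset.sum_image (f := fun j => f j ^ 2) (g := c) (fun x _ y _ h => hc h)]
      apply Finset.sum_le_sum_of_subset_of_nonneg
      · intro z hz
        obtain ⟨j, hj, rfl⟩ := Finset.mem_image.1 hz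
        exact hm j (Finset.mem_range.1 hj)
      · intros; positivity
    have c0 : 0 ≤ ∑ j ∈ Finset.range n, f (c j) ^ 2 := Finset.sum_nonneg fun _ _ => sq_nonneg _
    exact mul_le_mul hn' b c0 ((Nat.cast_nonneg n).trans hn')
  unfold SS
  split_ifs with h
  · apply key _ (fun j => (j : ℤ)) (by omega)
    · intro a b hab; simpa using hab
    · intro j hj; rw [Finset.mem_Icc]; omega
  · rw [neg_sq]
    apply key _ (fun j => -(j : ℤ) - 1) (by omega)
    · intro a b hab; simpa using hab
    · intro j hj; rw [Finset.mem_Icc]; omega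

/-- Six times the averaged path sum, in integer coordinates. -/
def TT (b0 b1 b2 : ℤ → ℤ → ℤ → ℝ) (i j k : ℤ) : ℝ :=
  (SS (fun s => b0 s 0 0) i + SS (fun s => b1 i s 0) j + SS (fun s => b2 i j s) k)
  + (SS (fun s => b0 s 0 0) i + SS (fun s => b2 i 0 s) k + SS (fun s => b1 i s k) j)
  + (SS (fun s => b1 0 s 0) j + SS (fun s => b0 s j 0) i + SS (fun s => b2 i j s) k)
  + (SS (fun s => b1 0 s 0) j + SS (fun s => b2 0 j s) k + SS (fun s => b0 s j k) i)
  + (SS (fun s => b2 0 0 s) k + SS (fun s => b0 s 0 k) i + SS (fun s => b1 i s k) j)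
  + (SS (fun s => b2 0 0 s) k + SS (fun s => b1 0 s k) j + SS (fun s => b0 s j k) i)

/-- Plaquette in the first two coordinates. -/
def PP (b0 b1 : ℤ → ℤ → ℤ → ℝ) (i j k : ℤ) : ℝ :=
  b0 i j k + b1 (i + 1) j k - b0 i (j + 1) k - b1 i j k

/-- Plaquette in the first and third coordinates. -/
def QQ (b0 b2 : ℤ → ℤ → ℤ → ℝ) (i j k : ℤ) : ℝ :=
  b0 i j k + b2 (i + 1) j k - b0 i j (k + 1) - b2 i j k

lemma strip (f g : ℤ → ℝ) (h P : ℤ → ℝ) (t : ℤ)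
    (hP : ∀ s, P s = h s + g s - h (s + 1) - f s) :
    SS g t = SS f t + SS P t + h t - h 0 := by
  have e : g = fun s => (f s + P s) + (h (s + 1) - h s) := by
    funext s; rw [hP]; ring
  rw [e, SS_add (fun s => f s + P s), SS_add f P, SS_tele]
  ring

lemma core_id (b0 b1 b2 : ℤ → ℤ → ℤ → ℝ) (i j k : ℤ)
    (h1 : TT b0 b1 b2 i j k = 0) (h2 : TT b0 b1 b2 (i + 1) j k = 0) :
    6 * b0 i j k = -(SS (fun s => PP b0 b1 i s 0) j + 2 * SS (fun s => QQ b0 b2 i j s) k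
      + SS (fun s => QQ b0 b2 i 0 s) k + 2 * SS (fun s => PP b0 b1 i s k) j) := by
  have a1 : ∀ k', SS (fun s => b1 (i + 1) s k') j = SS (fun s => b1 i s k') j
      + SS (fun s => PP b0 b1 i s k') j + b0 i j k' - b0 i 0 k' := fun k' =>
    strip _ _ (fun s => b0 i s k') _ _ (fun s => by simp [PP])
  have a2 : ∀ j', SS (fun s => b2 (i + 1) j' s) k = SS (fun s => b2 i j' s) k
      + SS (fun s => QQ b0 b2 i j' s) k + b0 i j' k - b0 i j' 0 := fun j' =>
    strip _ _ (fun s => b0 i j' s) _ _ (fun s => by simp [QQ])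
  unfold TT at h1 h2
  simp only [SS_succ, a1, a2] at h2
  linarith

lemma core_dir (b0 b1 b2 : ℤ → ℤ → ℤ → ℝ) (R : ℤ) (hR : 0 ≤ R)
    (hT : ∀ i ∈ Finset.Icc (-R) R, ∀ j ∈ Finset.Icc (-R) R, ∀ k ∈ Finset.Icc (-R) R,
      TT b0 b1 b2 i j k = 0) :
    ∑ i ∈ Finset.Icc (-R) (R - 1), ∑ j ∈ Finset.Icc (-R) R, ∑ k ∈ Finset.Icc (-R) R,
      b0 i j k ^ 2 ≤ (2 * (R : ℝ) + 1) ^ 2 * R / 2 *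
      ((∑ i ∈ Finset.Icc (-R) (R - 1), ∑ j ∈ Finset.Icc (-R) (R - 1), ∑ k ∈ Finset.Icc (-R) R,
          PP b0 b1 i j k ^ 2)
        + ∑ i ∈ Finset.Icc (-R) (R - 1), ∑ j ∈ Finset.Icc (-R) R, ∑ k ∈ Finset.Icc (-R) (R - 1),
          QQ b0 b2 i j k ^ 2) := by
  have hR' : (0 : ℝ) ≤ R := by exact_mod_cast hR
  rw [← Finset.sum_add_distrib, Finset.mul_sum]
  apply Finset.sum_le_sum
  intro i hi
  rw [Finset.mem_Icc] at hi
  set X := ∑ j ∈ Finset.Icc (-R) (R - 1), ∑ k ∈ Finset.Icc (-R) R, PP b0 b1 i j k ^ 2 with hX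
  set Y := ∑ j ∈ Finset.Icc (-R) R, ∑ k ∈ Finset.Icc (-R) (R - 1), QQ b0 b2 i j k ^ 2 with hY
  have main : ∀ j ∈ Finset.Icc (-R) R, ∀ k ∈ Finset.Icc (-R) R,
      b0 i j k ^ 2 ≤ R / 2 * (X + Y) := by
    intro j hj k hk
    have hid := core_id b0 b1 b2 i j k
      (hT i (Finset.mem_Icc.2 ⟨hi.1, by omega⟩) j hj k hk)
      (hT (i + 1) (Finset.mem_Icc.2 ⟨by omega, by omega⟩) j hj k hk)
    have p : ∀ k' ∈ Finset.Icc (-R) R, SS (fun s => PP b0 b1 i s k') j ^ 2 ≤ R * X := by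
      intro k' hk'
      rw [Finset.mem_Icc] at hj
      refine (SS_sq _ R j hj.1 hj.2).trans (mul_le_mul_of_nonneg_left ?_ hR')
      apply Finset.sum_le_sum
      intro s _
      exact Finset.single_le_sum (f := fun k => PP b0 b1 i s k ^ 2) (fun _ _ => sq_nonneg _) hk'
    have q : ∀ j' ∈ Finset.Icc (-R) R, SS (fun s => QQ b0 b2 i j' s) k ^ 2 ≤ R * Y := by
      intro j' hj'
      rw [Finset.mem_Icc] at hk
      refine (SS_sq _ R k hk.1 hk.2).trans (mul_le_mul_of_nonneg_left ?_ hR')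
      exact Finset.single_le_sum
        (f := fun j => ∑ k ∈ Finset.Icc (-R) (R - 1), QQ b0 b2 i j k ^ 2)
        (fun _ _ => Finset.sum_nonneg fun _ _ => sq_nonneg _) hj'
    have h0 : (0 : ℤ) ∈ Finset.Icc (-R) R := Finset.mem_Icc.2 ⟨by omega, hR⟩
    have p0 := p 0 h0
    have pk := p k hk
    have q0 := q 0 h0
    have qj := q j hj
    generalize SS (fun s => PP b0 b1 i s 0) j = s1 at *
    generalize SS (fun s => QQ b0 b2 i j s) k = s2 at *
    generalize SS (fun s => QQ b0 b2 i 0 s) k = s3 at *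
    generalize SS (fun s => PP b0 b1 i s k) j = s4 at *
    have e : b0 i j k = -(s1 + 2 * s2 + s3 + 2 * s4) / 6 := by linarith
    rw [e]
    nlinarith [sq_nonneg (s1 - s2), sq_nonneg (s1 - s3), sq_nonneg (s1 - s4),
      sq_nonneg (s2 - s3), sq_nonneg (s2 - s4), sq_nonneg (s3 - s4)]
  have c : ((Finset.Icc (-R) R).card : ℝ) = 2 * (R : ℝ) + 1 := by
    rw [Int.card_Icc]
    have : ((R + 1 - -R).toNat : ℤ) = 2 * R + 1 := by omega
    exact_mod_cast this
  calc _ ≤ ∑ j ∈ Finset.Icc (-R) R, ∑ k ∈ Finset.Icc (-R) R, (R : ℝ) / 2 * (X + Y) :=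
        Finset.sum_le_sum fun j hj => Finset.sum_le_sum fun k hk => main j hj k hk
    _ = _ := by
        simp only [Finset.sum_const, nsmul_eq_mul, c]
        ring

lemma core_all (b0 b1 b2 : ℤ → ℤ → ℤ → ℝ) (R : ℤ) (hR : 0 ≤ R)
    (hT : ∀ i ∈ Finset.Icc (-R) R, ∀ j ∈ Finset.Icc (-R) R, ∀ k ∈ Finset.Icc (-R) R,
      TT b0 b1 b2 i j k = 0) :
    (∑ i ∈ Finset.Icc (-R) (R - 1), ∑ j ∈ Finset.Icc (-R) R, ∑ k ∈ Finset.Icc (-R) R,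
      b0 i j k ^ 2)
    + (∑ i ∈ Finset.Icc (-R) R, ∑ j ∈ Finset.Icc (-R) (R - 1), ∑ k ∈ Finset.Icc (-R) R,
      b1 i j k ^ 2)
    + (∑ i ∈ Finset.Icc (-R) R, ∑ j ∈ Finset.Icc (-R) R, ∑ k ∈ Finset.Icc (-R) (R - 1),
      b2 i j k ^ 2)
    ≤ (2 * (R : ℝ) + 1) ^ 2 * R *
      ((∑ i ∈ Finset.Icc (-R) (R - 1), ∑ j ∈ Finset.Icc (-R) (R - 1), ∑ k ∈ Finset.Icc (-R) R,
          (b0 i j k + b1 (i + 1) j k - b0 i (j + 1) k - b1 i j k) ^ 2)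
        + (∑ i ∈ Finset.Icc (-R) (R - 1), ∑ j ∈ Finset.Icc (-R) R,
            ∑ k ∈ Finset.Icc (-R) (R - 1),
          (b0 i j k + b2 (i + 1) j k - b0 i j (k + 1) - b2 i j k) ^ 2)
        + ∑ i ∈ Finset.Icc (-R) R, ∑ j ∈ Finset.Icc (-R) (R - 1),
            ∑ k ∈ Finset.Icc (-R) (R - 1),
          (b1 i j k + b2 i (j + 1) k - b1 i j (k + 1) - b2 i j k) ^ 2) := by
  have d0 := core_dir b0 b1 b2 R hR hT
  have d1 := core_dir (fun j i k => b1 i j k) (fun j i k => b0 i j k) (fun j i k => b2 i j k)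
    R hR (fun j hj i hi k hk => by
      have := hT i hi j hj k hk
      unfold TT at *
      linarith)
  have d2 := core_dir (fun k i j => b2 i j k) (fun k i j => b0 i j k) (fun k i j => b1 i j k)
    R hR (fun k hk i hi j hj => by
      have := hT i hi j hj k hk
      unfold TT at *
      linarith)
  unfold PP QQ at d0 d1 d2
  -- left sides
  have l1 : ∑ i ∈ Finset.Icc (-R) (R - 1), ∑ j ∈ Finset.Icc (-R) R, ∑ k ∈ Finset.Icc (-R) R,
      b1 j i k ^ 2 = ∑ i ∈ Finset.Icc (-R) R, ∑ j ∈ Finset.Icc (-R) (R - 1),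
        ∑ k ∈ Finset.Icc (-R) R, b1 i j k ^ 2 := Finset.sum_comm
  have rot : ∀ (s t u : Finset ℤ) (f : ℤ → ℤ → ℤ → ℝ),
      ∑ k ∈ s, ∑ i ∈ t, ∑ j ∈ u, f i j k = ∑ i ∈ t, ∑ j ∈ u, ∑ k ∈ s, f i j k := by
    intro s t u f
    rw [Finset.sum_comm]
    exact Finset.sum_congr rfl fun i _ => Finset.sum_comm
  rw [rot _ _ _ (fun i j k => b2 i j k ^ 2), rot _ _ _
    (fun i j k => (b2 i j k + b0 i j (k + 1) - b2 (i + 1) j k - b0 i j k) ^ 2), rot _ _ _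
    (fun i j k => (b2 i j k + b1 i j (k + 1) - b2 i (j + 1) k - b1 i j k) ^ 2)] at d2
  rw [l1, Finset.sum_comm (s := Finset.Icc (-R) (R - 1)) (t := Finset.Icc (-R) (R - 1)),
    Finset.sum_comm (s := Finset.Icc (-R) (R - 1)) (t := Finset.Icc (-R) R)] at d1
  have e1 : ∀ i j k, (b1 i j k + b0 i (j + 1) k - b1 (i + 1) j k - b0 i j k) ^ 2
     = (b0 i j k + b1 (i + 1) j k - b0 i (j + 1) k - b1 i j k) ^ 2 := by intros; ring
  have e2 : ∀ i j k, (b2 i j k + b0 i j (k + 1) - b2 (i + 1) j k - b0 i j k) ^ 2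
     = (b0 i j k + b2 (i + 1) j k - b0 i j (k + 1) - b2 i j k) ^ 2 := by intros; ring
  have e3 : ∀ i j k, (b2 i j k + b1 i j (k + 1) - b2 i (j + 1) k - b1 i j k) ^ 2
     = (b1 i j k + b2 i (j + 1) k - b1 i j (k + 1) - b2 i j k) ^ 2 := by intros; ring
  simp only [e1] at d1
  simp only [e2, e3] at d2
  linarith

/-- Point of the torus with integer coordinates relative to `y`. -/
def pt {N : ℕ} (y : TPt N) (i j k : ℤ) : TPt N :=
  ![y 0 + (i : ZMod N), y 1 + (j : ZMod N), y 2 + (k : ZMod N)]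

lemma symRep_cast (N : ℕ) [NeZero N] (k : ℤ) (h1 : 2 * k + 1 ≤ N) (h2 : -2 * k + 1 ≤ N) :
    symRep N (k : ZMod N) = k := by
  have hN : 0 < N := Nat.pos_of_ne_zero (NeZero.ne N)
  unfold symRep
  rw [ZMod.val_intCast]
  by_cases h : 0 ≤ k
  · rw [Int.emod_eq_of_lt h (by omega), if_pos (by omega)]
  · have : k % (N : ℤ) = k + N := by
      rw [← Int.add_emod_right, Int.emod_eq_of_lt (by omega) (by omega)]
    rw [this, if_neg (by omega)]
    ring

lemma cast_symRep (N : ℕ) [NeZero N] (a : ZMod N) : ((symRep N a : ℤ) : ZMod N) = a := by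
  unfold symRep
  split_ifs <;> simp

lemma pt_mem {N : ℕ} [NeZero N] (y : TPt N) (R i j k : ℤ) (hN : 2 * R + 3 ≤ N)
    (hi : |i| ≤ R + 1) (hj : |j| ≤ R + 1) (hk : |k| ≤ R + 1) :
    pt y i j k ∈ blockF N R y ↔ |i| ≤ R ∧ |j| ≤ R ∧ |k| ≤ R := by
  rw [abs_le] at hi hj hk
  unfold blockF pt
  rw [Finset.mem_filter, Fin.forall_fin_succ, Fin.forall_fin_succ, Fin.forall_fin_succ]
  simp [symRep_cast N i (by omega) (by omega), symRep_cast N j (by omega) (by omega),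
    symRep_cast N k (by omega) (by omega)]

lemma pt_e0 {N : ℕ} (y : TPt N) (i j k : ℤ) : pt y i j k + unitVec N 0 = pt y (i + 1) j k := by
  funext a; fin_cases a <;> simp [pt, unitVec, add_assoc]
lemma pt_e1 {N : ℕ} (y : TPt N) (i j k : ℤ) : pt y i j k + unitVec N 1 = pt y i (j + 1) k := by
  funext a; fin_cases a <;> simp [pt, unitVec, add_assoc]
lemma pt_e2 {N : ℕ} (y : TPt N) (i j k : ℤ) : pt y i j k + unitVec N 2 = pt y i j (k + 1) := by
  funext a; fin_cases a <;> simp [pt, unitVec, add_assoc]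

lemma pt_s0 {N : ℕ} (y : TPt N) (i j k s : ℤ) :
    shiftT (pt y i j k) 0 s = pt y (i + s) j k := by
  funext a; fin_cases a <;> simp [pt, shiftT, add_assoc]
lemma pt_s1 {N : ℕ} (y : TPt N) (i j k s : ℤ) :
    shiftT (pt y i j k) 1 s = pt y i (j + s) k := by
  funext a; fin_cases a <;> simp [pt, shiftT, add_assoc]
lemma pt_s2 {N : ℕ} (y : TPt N) (i j k s : ℤ) :
    shiftT (pt y i j k) 2 s = pt y i j (k + s) := by
  funext a; fin_cases a <;> simp [pt, shiftT, add_assoc]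

lemma seg_gen {N : ℕ} (A : TPt N → TPt N → ℝ) (hA : ∀ x x', A x x' = - A x' x)
    (z : TPt N) (μ : Fin 3) (t : ℤ) :
    segT A z μ t = SS (fun s => A (shiftT z μ s) (shiftT z μ (s + 1))) t := by
  unfold segT SS
  split_ifs
  · rfl
  · rw [← Finset.sum_neg_distrib]
    apply Finset.sum_congr rfl
    intro j _
    simp only [sub_add_cancel]
    rw [hA]

lemma sum_perm3 (f : Equiv.Perm (Fin 3) → ℝ) :
    ∑ π, f π = f 1 + f (Equiv.swap 1 2) + f (Equiv.swap 0 1)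
      + f (Equiv.swap 0 1 * Equiv.swap 1 2) + f (Equiv.swap 1 2 * Equiv.swap 0 1)
      + f (Equiv.swap 0 2) := by
  have : (Finset.univ : Finset (Equiv.Perm (Fin 3))) = {1, Equiv.swap 1 2, Equiv.swap 0 1,
      Equiv.swap 0 1 * Equiv.swap 1 2, Equiv.swap 1 2 * Equiv.swap 0 1, Equiv.swap 0 2} := by
    decide
  rw [this, Finset.sum_insert (by decide), Finset.sum_insert (by decide),
    Finset.sum_insert (by decide), Finset.sum_insert (by decide),
    Finset.sum_insert (by decide), Finset.sum_singleton]
  ring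

lemma gamma_gen {N : ℕ} (A : TPt N → TPt N → ℝ) (π : Equiv.Perm (Fin 3)) (y x : TPt N)
    (p q r : Fin 3) (hp : π 0 = p) (hq : π 1 = q) (hr : π 2 = r) :
    gammaSumT A π y x = segT A y p (symRep N (x p - y p))
      + segT A (Function.update y p (x p)) q (symRep N (x q - y q))
      + segT A (Function.update x r (y r)) r (symRep N (x r - y r)) := by
  have hs : ∀ i : Fin 3, i = π (π.symm i) := fun i => by simp
  unfold gammaSumT
  rw [Fin.sum_univ_three, hp, hq, hr]
  have h0 : interPtT y x π ((0 : Fin 3) : ℕ) = y := by funext i; simp [interPtT]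
  have h1 : interPtT y x π ((1 : Fin 3) : ℕ) = Function.update y p (x p) := by
    funext i
    obtain ⟨m, rfl⟩ := π.surjective i
    subst hp
    fin_cases m <;> simp [interPtT]
  have h2 : interPtT y x π ((2 : Fin 3) : ℕ) = Function.update x r (y r) := by
    funext i
    obtain ⟨m, rfl⟩ := π.surjective i
    subst hr
    fin_cases m <;> simp [interPtT]
  rw [h0, h1, h2]

lemma tau_eq {N : ℕ} [NeZero N] (A : TPt N → TPt N → ℝ) (hA : ∀ x x', A x x' = - A x' x)
    (y : TPt N) (R i j k : ℤ) (hN : 2 * R + 3 ≤ N)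
    (hi : |i| ≤ R) (hj : |j| ≤ R) (hk : |k| ≤ R) :
    6 * tauBlk A y (pt y i j k) = TT (fun i j k => A (pt y i j k) (pt y (i + 1) j k))
      (fun i j k => A (pt y i j k) (pt y i (j + 1) k))
      (fun i j k => A (pt y i j k) (pt y i j (k + 1))) i j k := by
  rw [abs_le] at hi hj hk
  have s0 : symRep N (pt y i j k 0 - y 0) = i := by
    simp [pt, symRep_cast N i (by omega) (by omega)]
  have s1 : symRep N (pt y i j k 1 - y 1) = j := by
    simp [pt, symRep_cast N j (by omega) (by omega)]
  have s2 : symRep N (pt y i j k 2 - y 2) = k := by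
    simp [pt, symRep_cast N k (by omega) (by omega)]
  have y0 : y = pt y 0 0 0 := by funext a; fin_cases a <;> simp [pt]
  have u0 : Function.update y 0 (pt y i j k 0) = pt y i 0 0 := by
    funext a; fin_cases a <;> simp [pt]
  have u1 : Function.update y 1 (pt y i j k 1) = pt y 0 j 0 := by
    funext a; fin_cases a <;> simp [pt]
  have u2 : Function.update y 2 (pt y i j k 2) = pt y 0 0 k := by
    funext a; fin_cases a <;> simp [pt]
  have v0 : Function.update (pt y i j k) 0 (y 0) = pt y 0 j k := by
    funext a; fin_cases a <;> simp [pt]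
  have v1 : Function.update (pt y i j k) 1 (y 1) = pt y i 0 k := by
    funext a; fin_cases a <;> simp [pt]
  have v2 : Function.update (pt y i j k) 2 (y 2) = pt y i j 0 := by
    funext a; fin_cases a <;> simp [pt]
  have w : ∀ μ t, segT A y μ t = segT A (pt y 0 0 0) μ t := fun μ t => by rw [← y0]
  unfold tauBlk
  rw [sum_perm3,
    gamma_gen A 1 y _ 0 1 2 (by decide) (by decide) (by decide),
    gamma_gen A (Equiv.swap 1 2) y _ 0 2 1 (by decide) (by decide) (by decide),
    gamma_gen A (Equiv.swap 0 1) y _ 1 0 2 (by decide) (by decide) (by decide),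
    gamma_gen A (Equiv.swap 0 1 * Equiv.swap 1 2) y _ 1 2 0 (by decide) (by decide) (by decide),
    gamma_gen A (Equiv.swap 1 2 * Equiv.swap 0 1) y _ 2 0 1 (by decide) (by decide) (by decide),
    gamma_gen A (Equiv.swap 0 2) y _ 2 1 0 (by decide) (by decide) (by decide)]
  simp only [s0, s1, s2, u0, u1, u2, v0, v1, v2, w]
  simp only [seg_gen A hA, pt_s0, pt_s1, pt_s2, zero_add]
  unfold TT
  ring

lemma block_sum {N : ℕ} [NeZero N] (y : TPt N) (R : ℤ) (hN : 2 * R + 3 ≤ N)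
    (f : TPt N → ℝ) :
    ∑ x ∈ blockF N R y, f x = ∑ i ∈ Finset.Icc (-R) R, ∑ j ∈ Finset.Icc (-R) R,
      ∑ k ∈ Finset.Icc (-R) R, f (pt y i j k) := by
  have : ∑ i ∈ Finset.Icc (-R) R, ∑ j ∈ Finset.Icc (-R) R,
      ∑ k ∈ Finset.Icc (-R) R, f (pt y i j k)
      = ∑ p ∈ Finset.Icc (-R) R ×ˢ Finset.Icc (-R) R ×ˢ Finset.Icc (-R) R,
        f (pt y p.1 p.2.1 p.2.2) := by
    rw [Finset.sum_product]
    apply Finset.sum_congr rfl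
    intro i _
    rw [Finset.sum_product]
  rw [this]
  symm
  apply Finset.sum_bij' (fun p _ => pt y p.1 p.2.1 p.2.2)
    (fun x _ => (symRep N (x 0 - y 0), symRep N (x 1 - y 1), symRep N (x 2 - y 2)))
  · rintro ⟨i, j, k⟩ h
    simp only [Finset.mem_product, Finset.mem_Icc] at h
    rw [pt_mem y R i j k hN] <;> simp only [abs_le] <;> omega
  · intro x hx
    simp only [blockF, Finset.mem_filter, abs_le] at hx
    simp only [Finset.mem_product, Finset.mem_Icc]
    exact ⟨hx.2 0, hx.2 1, hx.2 2⟩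
  · rintro ⟨i, j, k⟩ h
    simp only [Finset.mem_product, Finset.mem_Icc] at h
    simp [pt, symRep_cast N i (by omega) (by omega), symRep_cast N j (by omega) (by omega),
      symRep_cast N k (by omega) (by omega)]
  · intro x hx
    funext a
    fin_cases a <;> simp [pt, cast_symRep]
  · intros; rfl

lemma sum_cut (R : ℤ) (f : ℤ → ℝ) :
    ∑ i ∈ Finset.Icc (-R) R, (if i + 1 ≤ R then f i else 0)
      = ∑ i ∈ Finset.Icc (-R) (R - 1), f i := by
  rw [← Finset.sum_filter]
  apply Finset.sum_congr _ (fun _ _ => rfl)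
  ext i
  simp only [Finset.mem_filter, Finset.mem_Icc]
  omega

lemma sum_ite_const (s : Finset ℤ) (p : Prop) [Decidable p] (f : ℤ → ℝ) :
    ∑ i ∈ s, (if p then f i else 0) = if p then ∑ i ∈ s, f i else 0 := by
  split_ifs <;> simp

set_option maxHeartbeats 1000000 in
lemma block_gen (N : ℕ) [NeZero N] (R : ℤ) (hR : 0 ≤ R) (hN : 2 * R + 3 ≤ N)
    (y : TPt N) (A : TPt N → TPt N → ℝ) (hA : ∀ x x', A x x' = - A x' x)
    (htau : ∀ x ∈ blockF N R y, tauBlk A y x = 0) :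
    (∑ x ∈ blockF N R y, ∑ μ : Fin 3,
        if x + unitVec N μ ∈ blockF N R y then (A x (x + unitVec N μ)) ^ 2 else 0)
      ≤ (2 * (R : ℝ) + 1) ^ 2 * R *
        ∑ x ∈ blockF N R y, ∑ μ : Fin 3, ∑ ν : Fin 3,
          if μ < ν ∧ x + unitVec N μ ∈ blockF N R y ∧ x + unitVec N ν ∈ blockF N R y ∧
              x + unitVec N μ + unitVec N ν ∈ blockF N R y
          then (plaqT A x μ ν) ^ 2 else 0 := by
  have hc := core_all (fun i j k => A (pt y i j k) (pt y (i + 1) j k))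
      (fun i j k => A (pt y i j k) (pt y i (j + 1) k))
      (fun i j k => A (pt y i j k) (pt y i j (k + 1))) R hR (by
    intro i hi j hj k hk
    rw [Finset.mem_Icc, ← abs_le] at hi hj hk
    rw [← tau_eq A hA y R i j k hN hi hj hk, htau, mul_zero]
    rw [pt_mem y R i j k hN (by omega) (by omega) (by omega)]
    exact ⟨hi, hj, hk⟩)
  rw [block_sum y R hN, block_sum y R hN]
  have hl : (∑ i ∈ Finset.Icc (-R) R, ∑ j ∈ Finset.Icc (-R) R, ∑ k ∈ Finset.Icc (-R) R,
      ∑ μ : Fin 3, if pt y i j k + unitVec N μ ∈ blockF N R y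
        then (A (pt y i j k) (pt y i j k + unitVec N μ)) ^ 2 else 0)
      = ∑ i ∈ Finset.Icc (-R) R, ∑ j ∈ Finset.Icc (-R) R, ∑ k ∈ Finset.Icc (-R) R,
        ((if i + 1 ≤ R then A (pt y i j k) (pt y (i + 1) j k) ^ 2 else 0)
        + (if j + 1 ≤ R then A (pt y i j k) (pt y i (j + 1) k) ^ 2 else 0)
        + (if k + 1 ≤ R then A (pt y i j k) (pt y i j (k + 1)) ^ 2 else 0)) := by
    refine Finset.sum_congr rfl fun i hi => Finset.sum_congr rfl fun j hj =>
      Finset.sum_congr rfl fun k hk => ?_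
    rw [Finset.mem_Icc] at hi hj hk
    have m0 : pt y (i + 1) j k ∈ blockF N R y ↔ i + 1 ≤ R := by
      rw [pt_mem y R (i + 1) j k hN (by rw [abs_le]; omega) (by rw [abs_le]; omega)
        (by rw [abs_le]; omega)]
      simp only [abs_le]; omega
    have m1 : pt y i (j + 1) k ∈ blockF N R y ↔ j + 1 ≤ R := by
      rw [pt_mem y R i (j + 1) k hN (by rw [abs_le]; omega) (by rw [abs_le]; omega)
        (by rw [abs_le]; omega)]
      simp only [abs_le]; omega
    have m2 : pt y i j (k + 1) ∈ blockF N R y ↔ k + 1 ≤ R := by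
      rw [pt_mem y R i j (k + 1) hN (by rw [abs_le]; omega) (by rw [abs_le]; omega)
        (by rw [abs_le]; omega)]
      simp only [abs_le]; omega
    simp only [Fin.sum_univ_three, pt_e0, pt_e1, pt_e2, m0, m1, m2]
  have hr : (∑ i ∈ Finset.Icc (-R) R, ∑ j ∈ Finset.Icc (-R) R, ∑ k ∈ Finset.Icc (-R) R,
      ∑ μ : Fin 3, ∑ ν : Fin 3,
          if μ < ν ∧ pt y i j k + unitVec N μ ∈ blockF N R y ∧
              pt y i j k + unitVec N ν ∈ blockF N R y ∧
              pt y i j k + unitVec N μ + unitVec N ν ∈ blockF N R y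
          then (plaqT A (pt y i j k) μ ν) ^ 2 else 0)
      = ∑ i ∈ Finset.Icc (-R) R, ∑ j ∈ Finset.Icc (-R) R, ∑ k ∈ Finset.Icc (-R) R,
        ((if i + 1 ≤ R then if j + 1 ≤ R then (plaqT A (pt y i j k) 0 1) ^ 2 else 0 else 0)
        + (if i + 1 ≤ R then if k + 1 ≤ R then (plaqT A (pt y i j k) 0 2) ^ 2 else 0 else 0)
        + (if j + 1 ≤ R then if k + 1 ≤ R then (plaqT A (pt y i j k) 1 2) ^ 2 else 0 else 0))
        := by
    refine Finset.sum_congr rfl fun i hi => Finset.sum_congr rfl fun j hj =>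
      Finset.sum_congr rfl fun k hk => ?_
    rw [Finset.mem_Icc] at hi hj hk
    have n10 : ¬ (1 : Fin 3) < 0 := by decide
    have n20 : ¬ (2 : Fin 3) < 0 := by decide
    have n21 : ¬ (2 : Fin 3) < 1 := by decide
    have n01 : (0 : Fin 3) < 1 := by decide
    have n02 : (0 : Fin 3) < 2 := by decide
    have n12 : (1 : Fin 3) < 2 := by decide
    simp only [Fin.sum_univ_three, lt_irrefl, n10, n20, n21, n01, n02, n12, false_and, true_and,
      if_false, zero_add, add_zero, pt_e0, pt_e1, pt_e2]
    have m0 : pt y (i + 1) j k ∈ blockF N R y ↔ i + 1 ≤ R := by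
      rw [pt_mem y R (i + 1) j k hN (by rw [abs_le]; omega) (by rw [abs_le]; omega)
        (by rw [abs_le]; omega)]
      simp only [abs_le]; omega
    have m1 : pt y i (j + 1) k ∈ blockF N R y ↔ j + 1 ≤ R := by
      rw [pt_mem y R i (j + 1) k hN (by rw [abs_le]; omega) (by rw [abs_le]; omega)
        (by rw [abs_le]; omega)]
      simp only [abs_le]; omega
    have m2 : pt y i j (k + 1) ∈ blockF N R y ↔ k + 1 ≤ R := by
      rw [pt_mem y R i j (k + 1) hN (by rw [abs_le]; omega) (by rw [abs_le]; omega)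
        (by rw [abs_le]; omega)]
      simp only [abs_le]; omega
    have m01 : pt y (i + 1) (j + 1) k ∈ blockF N R y ↔ i + 1 ≤ R ∧ j + 1 ≤ R := by
      rw [pt_mem y R (i + 1) (j + 1) k hN (by rw [abs_le]; omega) (by rw [abs_le]; omega)
        (by rw [abs_le]; omega)]
      simp only [abs_le]; omega
    have m02 : pt y (i + 1) j (k + 1) ∈ blockF N R y ↔ i + 1 ≤ R ∧ k + 1 ≤ R := by
      rw [pt_mem y R (i + 1) j (k + 1) hN (by rw [abs_le]; omega) (by rw [abs_le]; omega)
        (by rw [abs_le]; omega)]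
      simp only [abs_le]; omega
    have m12 : pt y i (j + 1) (k + 1) ∈ blockF N R y ↔ j + 1 ≤ R ∧ k + 1 ≤ R := by
      rw [pt_mem y R i (j + 1) (k + 1) hN (by rw [abs_le]; omega) (by rw [abs_le]; omega)
        (by rw [abs_le]; omega)]
      simp only [abs_le]; omega
    simp only [m0, m1, m2, m01, m02, m12, ← ite_and]
    congr 1
    · congr 1
      · exact if_congr ⟨fun h => ⟨h.1, h.2.1⟩, fun h => ⟨h.1, h.2, h⟩⟩ rfl rfl
      · exact if_congr ⟨fun h => ⟨h.1, h.2.1⟩, fun h => ⟨h.1, h.2, h⟩⟩ rfl rfl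
    · exact if_congr ⟨fun h => ⟨h.1, h.2.1⟩, fun h => ⟨h.1, h.2, h⟩⟩ rfl rfl
  rw [hl, hr]
  have q01 : ∀ i j k, plaqT A (pt y i j k) 0 1 = A (pt y i j k) (pt y (i + 1) j k)
      + A (pt y (i + 1) j k) (pt y (i + 1) (j + 1) k)
      - A (pt y i (j + 1) k) (pt y (i + 1) (j + 1) k) - A (pt y i j k) (pt y i (j + 1) k) := by
    intro i j k
    simp only [plaqT, pt_e0, pt_e1]
    rw [hA (pt y (i + 1) (j + 1) k), hA (pt y i (j + 1) k) (pt y i j k)]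
    ring
  have q02 : ∀ i j k, plaqT A (pt y i j k) 0 2 = A (pt y i j k) (pt y (i + 1) j k)
      + A (pt y (i + 1) j k) (pt y (i + 1) j (k + 1))
      - A (pt y i j (k + 1)) (pt y (i + 1) j (k + 1)) - A (pt y i j k) (pt y i j (k + 1)) := by
    intro i j k
    simp only [plaqT, pt_e0, pt_e2]
    rw [hA (pt y (i + 1) j (k + 1)), hA (pt y i j (k + 1)) (pt y i j k)]
    ring
  have q12 : ∀ i j k, plaqT A (pt y i j k) 1 2 = A (pt y i j k) (pt y i (j + 1) k)
      + A (pt y i (j + 1) k) (pt y i (j + 1) (k + 1))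
      - A (pt y i j (k + 1)) (pt y i (j + 1) (k + 1)) - A (pt y i j k) (pt y i j (k + 1)) := by
    intro i j k
    simp only [plaqT, pt_e1, pt_e2]
    rw [hA (pt y i (j + 1) (k + 1)), hA (pt y i j (k + 1)) (pt y i j k)]
    ring
  simp only [q01, q02, q12, Finset.sum_add_distrib, sum_ite_const, sum_cut]
  exact hc

/-- For a coarse site `y` and a gauge field `A` with `(τA)(y,·) = 0` on
the block `B(y)`, one has `Σ_{b ⊂ B(y)} A(b)² ≤ 3L³ · Σ_{p ⊂ B(y)} dA(p)²`, the sums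
running over the bonds and plaquettes all of whose vertices lie in `B(y)`. -/
theorem block_coercivity (L M : ℕ) (hL3 : 3 ≤ L) (hLodd : Odd L) (hM : 2 ≤ M)
    [NeZero (L ^ M)]
    (y : TPt (L ^ M)) (hy : isCoarse L (L ^ M) y)
    (A : TPt (L ^ M) → TPt (L ^ M) → ℝ) (hA : ∀ x x', A x x' = - A x' x)
    (htau : ∀ x ∈ blockF (L ^ M) (((L : ℤ) - 1) / 2) y, tauBlk A y x = 0) :
    (∑ x ∈ blockF (L ^ M) (((L : ℤ) - 1) / 2) y, ∑ μ : Fin 3,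
        if x + unitVec (L ^ M) μ ∈ blockF (L ^ M) (((L : ℤ) - 1) / 2) y
        then (A x (x + unitVec (L ^ M) μ)) ^ 2 else 0)
      ≤ 3 * (L : ℝ) ^ 3 *
        ∑ x ∈ blockF (L ^ M) (((L : ℤ) - 1) / 2) y, ∑ μ : Fin 3, ∑ ν : Fin 3,
          if μ < ν ∧ x + unitVec (L ^ M) μ ∈ blockF (L ^ M) (((L : ℤ) - 1) / 2) y ∧
              x + unitVec (L ^ M) ν ∈ blockF (L ^ M) (((L : ℤ) - 1) / 2) y ∧
              x + unitVec (L ^ M) μ + unitVec (L ^ M) ν ∈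
                blockF (L ^ M) (((L : ℤ) - 1) / 2) y
          then (plaqT A x μ ν) ^ 2 else 0 := by
  obtain ⟨r, hr⟩ := hLodd
  have hR : ((L : ℤ) - 1) / 2 = (r : ℤ) := by omega
  rw [hR] at htau ⊢
  have hN : L + 2 ≤ L ^ M := by
    calc L + 2 ≤ L ^ 2 := by nlinarith
      _ ≤ L ^ M := Nat.pow_le_pow_right (by omega) hM
  refine (block_gen (L ^ M) r (by omega) (by omega) y A hA htau).trans ?_
  have hLr : (L : ℝ) = 2 * (r : ℝ) + 1 := by exact_mod_cast hr
  have hr0 : (0 : ℝ) ≤ r := Nat.cast_nonneg r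
  apply mul_le_mul_of_nonneg_right
  · rw [hLr, Int.cast_natCast]
    nlinarith [mul_nonneg (sq_nonneg (2 * (r : ℝ) + 1)) hr0, sq_nonneg (2 * (r : ℝ) + 1)]
  · refine Finset.sum_nonneg fun x _ => Finset.sum_nonneg fun μ _ =>
      Finset.sum_nonneg fun ν _ => ?_
    split_ifs
    · exact sq_nonneg _
    · exact le_rfl
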